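/- For every γ ∈ (0,1) there exists r1 ∈ ℕ such that for every integer r0 sufficiently large in terms of r1 there exists n0 ∈ ℕ with the following property: for every n ≥ n0, if H is an n-vertex linear hypergraph in which every edge e satisfies r1 ≤ |e| ≤ r0, then there is a γ-bounded proper edge-colouring of H using at most γn colours. -/

import Mathlib

open Finset
open scoped Classical

/-- A hypergraph on vertex set `Fin n` is *linear* if any two distinct edges intersect in at
most one vertex. -/
def LinearHG {n : ℕ} (H : Finset (Finset (Fin n))) : Prop :=
  ∀ e ∈ H, ∀ f ∈ H, e ≠ f → (e ∩ f).card ≤ 1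

/-- `φ` is a proper edge-colouring of the hypergraph `H`. -/
def IsProperEC {n : ℕ} (H : Finset (Finset (Fin n))) (φ : Finset (Fin n) → ℕ) : Prop :=
  ∀ e ∈ H, ∀ f ∈ H, e ≠ f → (e ∩ f).Nonempty → φ e ≠ φ f

/-- The set of vertices incident to an edge of `H` coloured `c` by `φ`. -/
def vertsColoured {n : ℕ} (H : Finset (Finset (Fin n))) (φ : Finset (Fin n) → ℕ) (c : ℕ) :
    Finset (Fin n) :=
  Finset.univ.filter fun v => ∃ e ∈ H, φ e = c ∧ v ∈ e

/-- A proper edge-colouring is *α-bounded* if every colour is used at most once, or covers at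
most `αn` vertices. -/
def AlphaBounded {n : ℕ} (H : Finset (Finset (Fin n))) (φ : Finset (Fin n) → ℕ)
    (α : ℝ) : Prop :=
  ∀ c : ℕ, (H.filter fun e => φ e = c).card ≤ 1 ∨
    ((vertsColoured H φ c).card : ℝ) ≤ α * n

/-- `p` is the vector of vertex weights of a weighted family of independent subsets of `U`
of total weight `τ`. -/
def Realizable {ι : Type} [DecidableEq ι] (G : SimpleGraph ι) (U : Finset ι) (τ : ℝ)
    (p : ι → ℝ) : Prop :=
  ∃ (κ : Type) (_ : Fintype κ) (y : κ → ℝ) (M : κ → Finset ι),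
    (∀ k, 0 ≤ y k) ∧ (∀ k, M k ⊆ U) ∧ (∀ k, G.IsIndepSet (M k : Set ι)) ∧ ∑ k, y k = τ ∧
      ∀ e, p e = ∑ k, if e ∈ M k then y k else 0

namespace Realizable

variable {ι : Type} [DecidableEq ι] {G : SimpleGraph ι} {U W : Finset ι} {τ σ : ℝ}
  {p q : ι → ℝ}

lemma nonneg (h : Realizable G U τ p) (e : ι) : 0 ≤ p e := by
  obtain ⟨κ, _, y, M, hy, -, -, -, hp⟩ := h
  rw [hp]
  exact Finset.sum_nonneg fun k _ => by split_ifs <;> simp [hy k]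

lemma eq_zero (h : Realizable G U τ p) {e : ι} (he : e ∉ U) : p e = 0 := by
  obtain ⟨κ, _, y, M, -, hM, -, -, hp⟩ := h
  rw [hp]
  exact Finset.sum_eq_zero fun k _ => if_neg fun hk => he (hM k hk)

lemma mono (h : Realizable G U τ p) (hUW : U ⊆ W) : Realizable G W τ p := by
  obtain ⟨κ, i, y, M, hy, hM, hI, hs, hp⟩ := h
  exact ⟨κ, i, y, M, hy, fun k => (hM k).trans hUW, hI, hs, hp⟩

lemma of_const (hτ : 0 ≤ τ) : Realizable G U τ 0 :=
  ⟨Unit, inferInstance, fun _ => τ, fun _ => ∅, fun _ => hτ, by simp, by simp, by simp, by simp⟩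

lemma add (h : Realizable G U τ p) (h' : Realizable G U σ q) :
    Realizable G U (τ + σ) (p + q) := by
  obtain ⟨κ, i, y, M, hy, hM, hI, hs, hp⟩ := h
  obtain ⟨κ', i', y', M', hy', hM', hI', hs', hp'⟩ := h'
  refine ⟨κ ⊕ κ', inferInstance, Sum.elim y y', Sum.elim M M', ?_, ?_, ?_, ?_, ?_⟩
  · rintro (k | k) <;> simp [hy, hy']
  · rintro (k | k)
    exacts [hM k, hM' k]
  · rintro (k | k)
    exacts [hI k, hI' k]
  · simp [hs, hs']
  · intro e
    simp only [Pi.add_apply, hp, hp', Fintype.sum_sum_type, Sum.elim_inl, Sum.elim_inr]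
    congr!

lemma smul (h : Realizable G U τ p) {c : ℝ} (hc : 0 ≤ c) : Realizable G U (c * τ) (c • p) := by
  obtain ⟨κ, i, y, M, hy, hM, hI, hs, hp⟩ := h
  refine ⟨κ, i, fun k => c * y k, M, fun k => mul_nonneg hc (hy k), hM, hI, ?_, fun e => ?_⟩
  · rw [← Finset.mul_sum, hs]
  · simp [hp, Finset.mul_sum]

lemma of_le (h : Realizable G U τ p) (hτ : τ ≤ σ) : Realizable G U σ p := by
  simpa using h.add (of_const (sub_nonneg.2 hτ))

end Realizable

/-- If every nonempty `W ⊆ U` carries a random independent set for which each `e ∈ W` has expected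
weighted cover at least one, then `U` has a fractional colouring of total weight at most the
maximal total weight seen by an element. -/
theorem exists_realizable_eq_one {ι : Type} [DecidableEq ι] (G : SimpleGraph ι) (U : Finset ι)
    (c : ι → ι → ℝ) (B : ℝ) (hB0 : 0 ≤ B) (hc : ∀ e f, 0 ≤ c e f)
    (hB : ∀ e ∈ U, ∑ f ∈ U, c e f ≤ B)
    (h : ∀ W ⊆ U, W.Nonempty →
      ∃ p, Realizable G W 1 p ∧ ∀ e ∈ W, 1 ≤ ∑ f ∈ U, c e f * p f) :
    ∃ p, Realizable G U B p ∧ ∀ e ∈ U, p e = 1 := by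
  suffices key : ∀ W ⊆ U, ∀ τ p, τ ≤ B → Realizable G U τ p → (∀ e ∈ U, p e ≤ 1) →
      (∀ e ∈ U, e ∉ W → p e = 1) → (∀ e ∈ W, τ ≤ ∑ f ∈ U, c e f * p f) →
      ∃ p, Realizable G U B p ∧ ∀ e ∈ U, p e = 1 from
    key U subset_rfl 0 0 hB0 (.of_const le_rfl) (by simp) (by simp +contextual) (by simp)
  intro W
  induction W using Finset.strongInduction with
  | H W ih =>
    intro hWU τ p hτ hp hp1 hfull hcov
    rcases W.eq_empty_or_nonempty with rfl | hne
    · exact ⟨p, hp.of_le hτ, fun e he => hfull e he (by simp)⟩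
    obtain ⟨q, hq, hq1⟩ := h W hWU hne
    have hpos : (W.filter fun e => 0 < q e).Nonempty := by
      obtain ⟨e, he⟩ := hne
      by_contra! hemp
      have hz : ∀ f, q f = 0 := by
        intro f
        by_cases hf : f ∈ W
        · refine le_antisymm (not_lt.1 fun hlt => ?_) (hq.nonneg f)
          have : f ∈ W.filter fun e => 0 < q e := by simp [hf, hlt]
          simp [hemp] at this
        · exact hq.eq_zero hf
      have := hq1 e he
      simp [hz] at this
      linarith
    obtain ⟨e₀, he₀, hmin⟩ := Finset.exists_min_image _ (fun e => (1 - p e) / q e) hpos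
    rw [Finset.mem_filter] at he₀
    set t := (1 - p e₀) / q e₀ with ht
    have ht0 : 0 ≤ t := div_nonneg (sub_nonneg.2 (hp1 _ (hWU he₀.1))) he₀.2.le
    have hte : t * q e₀ = 1 - p e₀ := div_mul_cancel₀ _ he₀.2.ne'
    have hp' : Realizable G U (τ + t) (p + t • q) := by
      simpa using hp.add ((hq.mono hWU).smul ht0)
    have hp1' : ∀ e ∈ U, (p + t • q) e ≤ 1 := by
      intro e he
      by_cases hqe : 0 < q e
      · have heW : e ∈ W := by
          by_contra hn
          exact hqe.ne' (hq.eq_zero hn)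
        have := hmin e (by simp [heW, hqe])
        rw [le_div_iff₀ hqe] at this
        simp only [Pi.add_apply, Pi.smul_apply, smul_eq_mul]
        linarith
      · have : q e = 0 := le_antisymm (not_lt.1 hqe) (hq.nonneg e)
        simpa [this] using hp1 e he
    have hcov' : ∀ e ∈ W, τ + t ≤ ∑ f ∈ U, c e f * (p + t • q) f := by
      intro e he
      have h1 := hcov e he
      have h2 := mul_le_mul_of_nonneg_left (hq1 e he) ht0
      have : ∑ f ∈ U, c e f * (p + t • q) f =
          ∑ f ∈ U, c e f * p f + t * ∑ f ∈ U, c e f * q f := by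
        rw [Finset.mul_sum, ← Finset.sum_add_distrib]
        refine Finset.sum_congr rfl fun f _ => ?_
        simp only [Pi.add_apply, Pi.smul_apply, smul_eq_mul]
        ring
      linarith
    refine ih (W.erase e₀) (Finset.erase_ssubset he₀.1) ((Finset.erase_subset _ _).trans hWU)
      (τ + t) (p + t • q) ?_ hp' hp1' ?_ fun e he => hcov' e (Finset.mem_of_mem_erase he)
    · refine (hcov' e₀ he₀.1).trans (le_trans (Finset.sum_le_sum fun f hf => ?_)
        (hB e₀ (hWU he₀.1)))
      exact mul_le_of_le_one_right (hc _ _) (hp1' f hf)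
    · intro e he heW
      by_cases hee : e = e₀
      · subst hee
        simp [hte]
      · have : e ∉ W := fun hn => heW (Finset.mem_erase.2 ⟨hee, hn⟩)
        simp [hfull e he this, hq.eq_zero this]

lemma sum_union_le_add {α : Type*} [DecidableEq α] {w : α → ℝ} (hw : ∀ a, 0 ≤ w a)
    (s t : Finset α) : ∑ a ∈ s ∪ t, w a ≤ ∑ a ∈ s, w a + ∑ a ∈ t, w a := by
  rw [← Finset.sum_union_inter]
  exact le_add_of_nonneg_right (Finset.sum_nonneg fun a _ => hw a)

lemma sum_biUnion_le_sum {α β : Type*} [DecidableEq α] [DecidableEq β] {w : α → ℝ}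
    (hw : ∀ a, 0 ≤ w a) (s : Finset β) (t : β → Finset α) :
    ∑ a ∈ s.biUnion t, w a ≤ ∑ b ∈ s, ∑ a ∈ t b, w a := by
  induction s using Finset.induction_on with
  | empty => simp
  | insert b s hb ih =>
    rw [Finset.biUnion_insert, Finset.sum_insert hb]
    exact (sum_union_le_add hw _ _).trans (add_le_add le_rfl ih)

/-- The independent subsets of `W`. -/
noncomputable def indepSets {ι : Type} [DecidableEq ι] (G : SimpleGraph ι) (W : Finset ι) :
    Finset (Finset ι) :=
  W.powerset.filter fun I => G.IsIndepSet (I : Set ι)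

section HardCore

variable {ι : Type} [DecidableEq ι] {G : SimpleGraph ι} {W I J : Finset ι} {l : ℝ}

lemma mem_indepSets : I ∈ indepSets G W ↔ I ⊆ W ∧ G.IsIndepSet (I : Set ι) := by
  simp [indepSets]

lemma indepSets_anti (hI : I ∈ indepSets G W) (hJ : J ⊆ I) : J ∈ indepSets G W := by
  rw [mem_indepSets] at hI ⊢
  exact ⟨hJ.trans hI.1, hI.2.mono (by exact_mod_cast hJ)⟩

lemma not_adj_of_mem_indepSets (hI : I ∈ indepSets G W) {f g : ι} (hf : f ∈ I) (hg : g ∈ I) :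
    ¬ G.Adj f g := fun h =>
  (mem_indepSets.1 hI).2 (by exact_mod_cast hf) (by exact_mod_cast hg) h.ne h

lemma insert_mem_indepSets (hI : I ∈ indepSets G W) {f : ι} (hf : f ∈ W)
    (hfree : ∀ g ∈ I, ¬ G.Adj f g) : insert f I ∈ indepSets G W := by
  rw [mem_indepSets]
  refine ⟨Finset.insert_subset hf (mem_indepSets.1 hI).1, ?_⟩
  intro x hx y hy _ hadj
  simp only [Finset.coe_insert, Set.mem_insert_iff, Finset.mem_coe] at hx hy
  rcases hx with rfl | hx <;> rcases hy with rfl | hy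
  · exact G.irrefl hadj
  · exact hfree _ hy hadj
  · exact hfree _ hx hadj.symm
  · exact not_adj_of_mem_indepSets hI hx hy hadj

/-- Removing an element `g` from the independent sets containing it. -/
lemma sum_pow_card_mem_le (hl : 0 ≤ l) (g : ι) (P : Finset ι → Prop) [DecidablePred P]
    (hP : ∀ I, P I → P (I.erase g)) :
    ∑ I ∈ (indepSets G W).filter (fun I => g ∈ I ∧ P I), l ^ I.card ≤
      l * ∑ I ∈ (indepSets G W).filter (fun I => P I), l ^ I.card := by
  have hinj : Set.InjOn (fun I : Finset ι => I.erase g)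
      ((indepSets G W).filter (fun I => g ∈ I ∧ P I) : Finset (Finset ι)) := by
    intro I hI J hJ hIJ
    simp only [Finset.coe_filter, Set.mem_ofPred_eq] at hI hJ
    simp only at hIJ
    rw [← Finset.insert_erase hI.2.1, hIJ, Finset.insert_erase hJ.2.1]
  calc ∑ I ∈ (indepSets G W).filter (fun I => g ∈ I ∧ P I), l ^ I.card
      = ∑ I ∈ (indepSets G W).filter (fun I => g ∈ I ∧ P I), l * l ^ (I.erase g).card := by
        refine Finset.sum_congr rfl fun I hI => ?_
        rw [Finset.mem_filter] at hI
        rw [← pow_succ', Finset.card_erase_add_one hI.2.1]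
    _ = l * ∑ J ∈ ((indepSets G W).filter (fun I => g ∈ I ∧ P I)).image (fun I => I.erase g),
          l ^ J.card := by
        rw [← Finset.mul_sum, Finset.sum_image hinj]
    _ ≤ _ := by
        refine mul_le_mul_of_nonneg_left (Finset.sum_le_sum_of_subset_of_nonneg ?_
          fun _ _ _ => by positivity) hl
        intro J hJ
        simp only [Finset.mem_image, Finset.mem_filter] at hJ ⊢
        obtain ⟨I, ⟨hI, -, hPI⟩, rfl⟩ := hJ
        exact ⟨indepSets_anti hI (Finset.erase_subset _ _), hP I hPI⟩

lemma sum_pow_card_mem_eq {f : ι} (hf : f ∈ W) :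
    ∑ I ∈ (indepSets G W).filter (fun I => f ∈ I), l ^ I.card =
      l * ∑ I ∈ (indepSets G W).filter (fun I => f ∉ I ∧ ∀ g ∈ I, ¬ G.Adj f g), l ^ I.card := by
  rw [Finset.mul_sum]
  refine Finset.sum_bij' (fun I _ => I.erase f) (fun I _ => insert f I) ?_ ?_ ?_ ?_ ?_
  · intro I hI
    simp only [Finset.mem_filter] at hI ⊢
    refine ⟨indepSets_anti hI.1 (Finset.erase_subset _ _), by simp, fun g hg => ?_⟩
    exact not_adj_of_mem_indepSets hI.1 hI.2 (Finset.mem_of_mem_erase hg)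
  · intro I hI
    simp only [Finset.mem_filter] at hI ⊢
    exact ⟨insert_mem_indepSets hI.1 hf hI.2.2, by simp⟩
  · intro I hI
    simp only [Finset.mem_filter] at hI
    exact Finset.insert_erase hI.2
  · intro I hI
    simp only [Finset.mem_filter] at hI
    exact Finset.erase_insert hI.2.1
  · intro I hI
    simp only [Finset.mem_filter] at hI
    rw [← pow_succ', Finset.card_erase_add_one hI.2]

/-- The part of `I` outside the closed neighbourhood of `e`. -/
noncomputable def outerPart (G : SimpleGraph ι) (e : ι) (I : Finset ι) : Finset ι :=
  I.filter fun g => g ≠ e ∧ ¬ G.Adj e g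

/-- The neighbours of `e` in `W` that are not adjacent to the outer part of `I`. -/
noncomputable def availableNbrs (G : SimpleGraph ι) (W : Finset ι) (e : ι) (I : Finset ι) :
    Finset ι :=
  W.filter fun f => G.Adj e f ∧ ∀ g ∈ outerPart G e I, ¬ G.Adj f g

lemma outerPart_outerPart (e : ι) (I : Finset ι) :
    outerPart G e (outerPart G e I) = outerPart G e I := by
  ext g
  simp only [outerPart, Finset.mem_filter]
  tauto

lemma outerPart_subset (e : ι) (I : Finset ι) : outerPart G e I ⊆ I :=
  Finset.filter_subset _ _

/-- Given the outer part, the remaining partition function is at most the one of independent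
choices. -/
lemma sum_exp_availableNbrs_le (hl : 0 < l) (hl1 : l ≤ 1) {e : ι} :
    ∑ I ∈ indepSets G W, l ^ I.card * Real.exp (-(l * (availableNbrs G W e I).card)) ≤
      2 * ∑ I ∈ (indepSets G W).filter (fun I => e ∉ I ∧ ∀ g ∈ I, ¬ G.Adj e g), l ^ I.card := by
  set S₀ := (indepSets G W).filter (fun I => e ∉ I ∧ ∀ g ∈ I, ¬ G.Adj e g) with hS₀
  have hmaps : ∀ I ∈ indepSets G W, outerPart G e I ∈ S₀ := by
    intro I hI
    simp only [hS₀, Finset.mem_filter]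
    refine ⟨indepSets_anti hI (outerPart_subset e I), ?_, ?_⟩
    · simp [outerPart]
    · intro g hg
      simp only [outerPart, Finset.mem_filter] at hg
      exact hg.2.2
  rw [← Finset.sum_fiberwise_of_maps_to hmaps, Finset.mul_sum]
  refine Finset.sum_le_sum fun Z hZ => ?_
  set A := availableNbrs G W e Z with hA
  have hfib : ∀ I ∈ (indepSets G W).filter (fun I => outerPart G e I = Z),
      availableNbrs G W e I = A := by
    intro I hI
    rw [Finset.mem_filter] at hI
    have : outerPart G e Z = outerPart G e I := by rw [← hI.2, outerPart_outerPart]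
    simp only [hA, availableNbrs, this]
  have hsub : ∀ I ∈ (indepSets G W).filter (fun I => outerPart G e I = Z), Z ⊆ I := by
    intro I hI
    rw [Finset.mem_filter] at hI
    exact hI.2 ▸ outerPart_subset e I
  have hinj : Set.InjOn (fun I : Finset ι => I \ Z)
      ((indepSets G W).filter (fun I => outerPart G e I = Z) : Finset (Finset ι)) := by
    intro I hI J hJ hIJ
    simp only at hIJ
    rw [← Finset.sdiff_union_of_subset (hsub I hI), hIJ, Finset.sdiff_union_of_subset (hsub J hJ)]
  have himg : ((indepSets G W).filter (fun I => outerPart G e I = Z)).image (fun I => I \ Z) ⊆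
      (insert e A).powerset := by
    intro J hJ
    simp only [Finset.mem_image, Finset.mem_filter] at hJ
    obtain ⟨I, ⟨hI, hIZ⟩, rfl⟩ := hJ
    rw [Finset.mem_powerset]
    intro g hg
    rw [Finset.mem_sdiff] at hg
    by_cases hge : g = e
    · simp [hge]
    refine Finset.mem_insert_of_mem ?_
    simp only [hA, availableNbrs, Finset.mem_filter]
    refine ⟨(mem_indepSets.1 hI).1 hg.1, ?_, ?_⟩
    · by_contra hn
      apply hg.2
      rw [← hIZ]
      simp [outerPart, hg.1, hge, hn]
    · intro z hz
      have hzI : z ∈ I := by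
        have h1 := outerPart_subset (G := G) e Z hz
        rw [← hIZ] at h1
        exact outerPart_subset e I h1
      exact not_adj_of_mem_indepSets hI hg.1 hzI
  have heA : e ∉ A := by simp [hA, availableNbrs]
  have hsum : ∑ I ∈ (indepSets G W).filter (fun I => outerPart G e I = Z), l ^ I.card ≤
      l ^ Z.card * (1 + l) ^ (A.card + 1) := by
    calc ∑ I ∈ (indepSets G W).filter (fun I => outerPart G e I = Z), l ^ I.card
        = ∑ I ∈ (indepSets G W).filter (fun I => outerPart G e I = Z),
            l ^ Z.card * l ^ (I \ Z).card := by
          refine Finset.sum_congr rfl fun I hI => ?_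
          rw [← pow_add, add_comm, Finset.card_sdiff_add_card_eq_card (hsub I hI)]
      _ = l ^ Z.card * ∑ J ∈ ((indepSets G W).filter
            (fun I => outerPart G e I = Z)).image (fun I => I \ Z), l ^ J.card := by
          rw [← Finset.mul_sum, Finset.sum_image hinj]
      _ ≤ l ^ Z.card * ∑ J ∈ (insert e A).powerset, l ^ J.card := by
          refine mul_le_mul_of_nonneg_left (Finset.sum_le_sum_of_subset_of_nonneg himg
            fun _ _ _ => by positivity) (by positivity)
      _ = l ^ Z.card * (1 + l) ^ (A.card + 1) := by
          have := Finset.sum_pow_mul_eq_add_pow l 1 (insert e A)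
          simp only [one_pow, mul_one] at this
          rw [this, Finset.card_insert_of_notMem heA, add_comm]
  have hexp : (1 + l) ^ A.card * Real.exp (-(l * A.card)) ≤ 1 := by
    have h1 : (1 + l) ^ A.card ≤ Real.exp (l * A.card) := by
      rw [mul_comm, Real.exp_nat_mul]
      exact pow_le_pow_left₀ (by positivity) (by linarith [Real.add_one_le_exp l]) _
    calc _ ≤ Real.exp (l * A.card) * Real.exp (-(l * A.card)) :=
          mul_le_mul_of_nonneg_right h1 (Real.exp_pos _).le
      _ = 1 := by rw [← Real.exp_add]; simp
  calc ∑ I ∈ (indepSets G W).filter (fun I => outerPart G e I = Z),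
        l ^ I.card * Real.exp (-(l * (availableNbrs G W e I).card))
      = (∑ I ∈ (indepSets G W).filter (fun I => outerPart G e I = Z), l ^ I.card) *
          Real.exp (-(l * A.card)) := by
        rw [Finset.sum_mul]
        exact Finset.sum_congr rfl fun I hI => by rw [hfib I hI]
    _ ≤ (l ^ Z.card * (1 + l) ^ (A.card + 1)) * Real.exp (-(l * A.card)) :=
        mul_le_mul_of_nonneg_right hsum (Real.exp_pos _).le
    _ = l ^ Z.card * (1 + l) * ((1 + l) ^ A.card * Real.exp (-(l * A.card))) := by ring
    _ ≤ l ^ Z.card * (1 + l) * 1 := mul_le_mul_of_nonneg_left hexp (by positivity)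
    _ ≤ 2 * l ^ Z.card := by nlinarith [pow_pos hl Z.card]

/-- A neighbour of `e` that is not blocked from outside is occupied with good probability. -/
lemma sum_available_le (hl : 0 < l) (hl1 : l ≤ 1 / 2) {e f : ι} (hf : f ∈ W)
    (hcod : l * (W.filter fun g => G.Adj f g ∧ (g = e ∨ G.Adj e g)).card ≤ 1 / 4) :
    l * ∑ I ∈ (indepSets G W).filter (fun I => ∀ g ∈ outerPart G e I, ¬ G.Adj f g), l ^ I.card ≤
      2 * ∑ I ∈ (indepSets G W).filter (fun I => f ∈ I), l ^ I.card := by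
  set X := ∑ I ∈ (indepSets G W).filter (fun I => ∀ g ∈ outerPart G e I, ¬ G.Adj f g), l ^ I.card
    with hX
  have hfree := sum_pow_card_mem_eq (G := G) (l := l) hf
  set Y := ∑ I ∈ (indepSets G W).filter (fun I => f ∈ I), l ^ I.card
  set F := ∑ I ∈ (indepSets G W).filter (fun I => f ∉ I ∧ ∀ g ∈ I, ¬ G.Adj f g), l ^ I.card
    with hF
  set C := W.filter fun g => G.Adj f g ∧ (g = e ∨ G.Adj e g) with hC
  have hX0 : 0 ≤ X := Finset.sum_nonneg fun _ _ => by positivity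
  have hY0 : 0 ≤ Y := Finset.sum_nonneg fun _ _ => by positivity
  have hblock : ∀ g ∈ C, ∑ I ∈ (indepSets G W).filter
      (fun I => g ∈ I ∧ ∀ g ∈ outerPart G e I, ¬ G.Adj f g), l ^ I.card ≤ l * X := by
    intro g _
    refine sum_pow_card_mem_le hl.le g (fun I => ∀ g ∈ outerPart G e I, ¬ G.Adj f g)
      fun I hI g' hg' => hI g' ?_
    simp only [outerPart, Finset.mem_filter, Finset.mem_erase] at hg' ⊢
    exact ⟨hg'.1.2, hg'.2⟩
  have hsplit : X ≤ Y + F + ∑ g ∈ C, ∑ I ∈ (indepSets G W).filter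
      (fun I => g ∈ I ∧ ∀ g ∈ outerPart G e I, ¬ G.Adj f g), l ^ I.card := by
    have hcover : (indepSets G W).filter (fun I => ∀ g ∈ outerPart G e I, ¬ G.Adj f g) ⊆
        ((indepSets G W).filter (fun I => f ∈ I) ∪
          (indepSets G W).filter (fun I => f ∉ I ∧ ∀ g ∈ I, ¬ G.Adj f g)) ∪
        C.biUnion fun g => (indepSets G W).filter
          (fun I => g ∈ I ∧ ∀ g ∈ outerPart G e I, ¬ G.Adj f g) := by
      intro I hI
      simp only [Finset.mem_union, Finset.mem_biUnion, Finset.mem_filter] at hI ⊢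
      by_cases hfI : f ∈ I
      · exact Or.inl (Or.inl ⟨hI.1, hfI⟩)
      by_cases hfr : ∀ g ∈ I, ¬ G.Adj f g
      · exact Or.inl (Or.inr ⟨hI.1, hfI, hfr⟩)
      push Not at hfr
      obtain ⟨g, hgI, hfg⟩ := hfr
      refine Or.inr ⟨g, ?_, hI.1, hgI, hI.2⟩
      simp only [hC, Finset.mem_filter]
      refine ⟨(mem_indepSets.1 hI.1).1 hgI, hfg, ?_⟩
      by_contra hn
      push Not at hn
      exact hI.2 g (by simp [outerPart, hgI, hn]) hfg
    have hnn : ∀ I : Finset ι, 0 ≤ l ^ I.card := fun I => by positivity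
    refine (Finset.sum_le_sum_of_subset_of_nonneg hcover fun I _ _ => hnn I).trans ?_
    refine (sum_union_le_add hnn _ _).trans (add_le_add (sum_union_le_add hnn _ _) ?_)
    exact sum_biUnion_le_sum hnn _ _
  have hsumC : ∑ g ∈ C, ∑ I ∈ (indepSets G W).filter
      (fun I => g ∈ I ∧ ∀ g ∈ outerPart G e I, ¬ G.Adj f g), l ^ I.card ≤ C.card * (l * X) := by
    have := Finset.sum_le_sum hblock
    simpa using this
  have h1 : (C.card : ℝ) * (l * X) ≤ 1 / 4 * X := by
    have := mul_le_mul_of_nonneg_right hcod hX0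
    linarith
  have h2 : l * Y ≤ 1 / 2 * Y := mul_le_mul_of_nonneg_right hl1 hY0
  have h3 : l * X ≤ l * (Y + F + 1 / 4 * X) := mul_le_mul_of_nonneg_left (by linarith) hl.le
  nlinarith

end HardCore

/-- The hard-core model at low fugacity: if few neighbours of `e` occupy it in expectation, then
`e` itself is occupied with good probability, provided codegrees are small. -/
theorem exists_realizable_hardCore {ι : Type} [DecidableEq ι] (G : SimpleGraph ι) (W : Finset ι)
    {l : ℝ} (hl : 0 < l) (hl1 : l ≤ 1 / 2)
    (hcod : ∀ e ∈ W, ∀ f ∈ W, G.Adj e f →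
      l * (W.filter fun g => G.Adj f g ∧ (g = e ∨ G.Adj e g)).card ≤ 1 / 4) :
    ∃ p, Realizable G W 1 p ∧
      ∀ e ∈ W, l / 2 * Real.exp (-(2 * ∑ f ∈ W.filter (G.Adj e), p f)) ≤ p e := by
  set S := indepSets G W with hS
  set Z := ∑ I ∈ S, l ^ I.card with hZ
  have hZ0 : 0 < Z := by
    refine Finset.sum_pos (fun I _ => by positivity) ⟨∅, ?_⟩
    simp [hS, mem_indepSets]
  set p : ι → ℝ := fun e => (∑ I ∈ S.filter (fun I => e ∈ I), l ^ I.card) / Z with hp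
  have hsum1 : ∑ I ∈ S, l ^ I.card / Z = 1 := by
    rw [← Finset.sum_div, ← hZ, div_self hZ0.ne']
  refine ⟨p, ⟨S, inferInstance, fun I => l ^ I.1.card / Z, fun I => I.1, fun I => by positivity,
    fun I => (mem_indepSets.1 I.2).1, fun I => (mem_indepSets.1 I.2).2, ?_, fun e => ?_⟩, ?_⟩
  · rw [Finset.sum_coe_sort S (fun I => l ^ I.card / Z), hsum1]
  · rw [Finset.sum_coe_sort S (fun I => if e ∈ I then l ^ I.card / Z else 0),
      ← Finset.sum_filter, ← Finset.sum_div]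
  intro e he
  set N := W.filter (G.Adj e) with hN
  set P₀ := ∑ I ∈ S.filter (fun I => e ∉ I ∧ ∀ g ∈ I, ¬ G.Adj e g), l ^ I.card with hP₀
  have hpe : p e = l * P₀ / Z := by
    simp only [hp, hS, hP₀]
    rw [sum_pow_card_mem_eq he]
  set EA := ∑ I ∈ S, l ^ I.card / Z * (l * (availableNbrs G W e I).card) with hEA
  have hjensen : Real.exp (-EA) ≤
      ∑ I ∈ S, l ^ I.card / Z * Real.exp (-(l * (availableNbrs G W e I).card)) := by
    have := convexOn_exp.map_sum_le (t := S) (w := fun I => l ^ I.card / Z)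
      (p := fun I => -(l * ((availableNbrs G W e I).card : ℝ))) (fun I _ => by positivity)
      hsum1 (fun I _ => Set.mem_univ _)
    simpa [hEA] using this
  have hupper : ∑ I ∈ S, l ^ I.card / Z * Real.exp (-(l * (availableNbrs G W e I).card)) ≤
      2 * P₀ / Z := by
    have := sum_exp_availableNbrs_le (G := G) (W := W) hl (by linarith) (e := e)
    calc _ = (∑ I ∈ S, l ^ I.card * Real.exp (-(l * (availableNbrs G W e I).card))) / Z := by
          rw [Finset.sum_div]
          exact Finset.sum_congr rfl fun I _ => by ring
      _ ≤ _ := div_le_div_of_nonneg_right this hZ0.le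
  have hEAle : EA ≤ 2 * ∑ f ∈ N, p f := by
    have hcard : ∀ I, ((availableNbrs G W e I).card : ℝ) =
        ∑ f ∈ N, if ∀ g ∈ outerPart G e I, ¬ G.Adj f g then 1 else 0 := by
      intro I
      rw [Finset.sum_boole, hN, Finset.filter_filter]
      rfl
    calc EA = ∑ f ∈ N, (l * ∑ I ∈ S.filter (fun I => ∀ g ∈ outerPart G e I, ¬ G.Adj f g),
          l ^ I.card) / Z := by
          simp only [hEA, hcard, Finset.mul_sum]
          rw [Finset.sum_comm]
          refine Finset.sum_congr rfl fun f _ => ?_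
          rw [Finset.sum_filter, Finset.sum_div]
          refine Finset.sum_congr rfl fun I _ => ?_
          split_ifs
          · ring
          · simp
      _ ≤ ∑ f ∈ N, (2 * ∑ I ∈ S.filter (fun I => f ∈ I), l ^ I.card) / Z := by
          refine Finset.sum_le_sum fun f hf => div_le_div_of_nonneg_right ?_ hZ0.le
          rw [hN, Finset.mem_filter] at hf
          exact sum_available_le hl hl1 hf.1 (hcod e he f hf.1 hf.2)
      _ = 2 * ∑ f ∈ N, p f := by
          rw [Finset.mul_sum]
          exact Finset.sum_congr rfl fun f _ => mul_div_assoc _ _ _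
  have hexp : Real.exp (-(2 * ∑ f ∈ N, p f)) ≤ 2 * P₀ / Z :=
    (Real.exp_le_exp.2 (by linarith)).trans (hjensen.trans hupper)
  calc l / 2 * Real.exp (-(2 * ∑ f ∈ N, p f)) ≤ l / 2 * (2 * P₀ / Z) :=
        mul_le_mul_of_nonneg_left hexp (by positivity)
    _ = p e := by rw [hpe]; ring

/-- A graph with bounded degrees and small codegrees has a fractional colouring of weight much
smaller than its maximum degree. -/
theorem exists_realizable_eq_one_of_codegree {ι : Type} [DecidableEq ι] (G : SimpleGraph ι)
    (U : Finset ι) {l D T : ℝ} (hl : 0 < l) (hl1 : l ≤ 1 / 2) (hT : 0 < T) (hD : 0 ≤ D)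
    (hdeg : ∀ e ∈ U, ((U.filter (G.Adj e)).card : ℝ) ≤ D)
    (hcod : ∀ e ∈ U, ∀ f ∈ U, G.Adj e f →
      l * (U.filter fun g => G.Adj f g ∧ (g = e ∨ G.Adj e g)).card ≤ 1 / 4) :
    ∃ p, Realizable G U (2 / l * Real.exp (2 * T) + D / T) p ∧ ∀ e ∈ U, p e = 1 := by
  set a := 2 / l * Real.exp (2 * T) with ha
  have ha0 : 0 < a := by positivity
  have hsum : ∀ e ∈ U, ∀ p : ι → ℝ,
      ∑ f ∈ U, ((if e = f then a else 0) + if G.Adj e f then 1 / T else 0) * p f =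
        a * p e + 1 / T * ∑ f ∈ U.filter (G.Adj e), p f := by
    intro e he p
    simp only [add_mul, ite_mul, zero_mul, Finset.sum_add_distrib, Finset.sum_ite_eq, he, if_true]
    rw [← Finset.sum_filter, Finset.mul_sum]
  refine exists_realizable_eq_one G U
    (fun e f => (if e = f then a else 0) + if G.Adj e f then 1 / T else 0) _ (by positivity)
    (fun e f => by split_ifs <;> positivity) ?_ ?_
  · intro e he
    have := hsum e he 1
    simp only [Pi.one_apply, mul_one, Finset.sum_const, nsmul_eq_mul] at this
    rw [this, div_eq_mul_one_div D, mul_comm D]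
    have := mul_le_mul_of_nonneg_left (hdeg e he) (by positivity : 0 ≤ 1 / T)
    linarith
  · intro W hWU _
    obtain ⟨p, hp, hpe⟩ := exists_realizable_hardCore G W hl hl1 fun e he f hf hef => by
      refine le_trans (mul_le_mul_of_nonneg_left ?_ hl.le) (hcod e (hWU he) f (hWU hf) hef)
      exact_mod_cast Finset.card_le_card (Finset.filter_subset_filter _ hWU)
    refine ⟨p, hp, fun e he => ?_⟩
    rw [hsum e (hWU he)]
    have hle : ∑ f ∈ W.filter (G.Adj e), p f ≤ ∑ f ∈ U.filter (G.Adj e), p f :=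
      Finset.sum_le_sum_of_subset_of_nonneg (Finset.filter_subset_filter _ hWU)
        fun f _ _ => hp.nonneg f
    have hW0 : 0 ≤ ∑ f ∈ W.filter (G.Adj e), p f := Finset.sum_nonneg fun f _ => hp.nonneg f
    rcases le_total T (∑ f ∈ U.filter (G.Adj e), p f) with h | h
    · have h1 : 1 ≤ 1 / T * ∑ f ∈ U.filter (G.Adj e), p f := by
        rw [one_div, ← div_eq_inv_mul, le_div_iff₀ hT]
        linarith
      have := mul_nonneg ha0.le (hp.nonneg e)
      linarith
    · have h1 : l / 2 * Real.exp (-(2 * T)) ≤ p e :=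
        (mul_le_mul_of_nonneg_left (Real.exp_le_exp.2 (by linarith)) (by positivity)).trans
          (hpe e he)
      have h2 : a * (l / 2 * Real.exp (-(2 * T))) = 1 := by
        rw [ha, Real.exp_neg]
        field_simp
      have h3 := mul_le_mul_of_nonneg_left h1 ha0.le
      have h4 : 0 ≤ 1 / T * ∑ f ∈ U.filter (G.Adj e), p f :=
        mul_nonneg (by positivity) (hW0.trans hle)
      linarith

/-- Two random independent sets can be merged, losing a factor of at most two on the second,
when few conflicts are expected. -/
theorem Realizable.exists_union {ι : Type} [DecidableEq ι] {G : SimpleGraph ι} {U V : Finset ι}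
    {p₁ p₂ : ι → ℝ} {q : ℝ} (h₁ : Realizable G U 1 p₁) (h₂ : Realizable G V 1 p₂)
    (hUV : Disjoint U V) (hp₁ : ∀ e ∈ U, p₁ e ≤ q) (hp₂ : ∀ e ∈ V, p₂ e = q)
    (hcon : ∀ e ∈ V, ((U.filter (G.Adj e)).card : ℝ) * q ≤ 1 / 2) :
    ∃ p, Realizable G (U ∪ V) 1 p ∧ (∀ e ∈ U, p e = p₁ e) ∧
      ∀ e ∈ V, q / 2 ≤ p e ∧ p e ≤ q := by
  have hnn := h₂.nonneg
  have hnn₁ := h₁.nonneg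
  obtain ⟨κ, _, y, M, hy, hM, hI, hs, hp⟩ := h₁
  obtain ⟨κ', _, y', M', hy', hM', hI', hs', hp'⟩ := h₂
  set N : κ × κ' → Finset ι :=
    fun k => M k.1 ∪ (M' k.2).filter fun e => ∀ f ∈ M k.1, ¬ G.Adj e f with hN
  refine ⟨fun e => ∑ k : κ × κ', if e ∈ N k then y k.1 * y' k.2 else 0,
    ⟨κ × κ', inferInstance, fun k => y k.1 * y' k.2, N, fun k => mul_nonneg (hy _) (hy' _),
      fun k => Finset.union_subset_union (hM _) ((Finset.filter_subset _ _).trans (hM' _)),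
      fun k => ?_, ?_, fun e => rfl⟩, fun e he => ?_, fun e he => ?_⟩
  · intro e he f hf hef hadj
    simp only [hN, Finset.coe_union, Finset.coe_filter, Set.mem_union, Finset.mem_coe,
      Set.mem_ofPred_eq] at he hf
    rcases he with he | he <;> rcases hf with hf | hf
    · exact hI _ (by exact_mod_cast he) (by exact_mod_cast hf) hef hadj
    · exact hf.2 e he hadj.symm
    · exact he.2 f hf hadj
    · exact hI' _ (by exact_mod_cast he.1) (by exact_mod_cast hf.1) hef hadj
  · rw [Fintype.sum_prod_type, ← Finset.sum_mul_sum, hs, hs', mul_one]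
  · have hmem : ∀ k, e ∈ N k ↔ e ∈ M k.1 := by
      intro k
      have : e ∉ M' k.2 := fun h => Finset.disjoint_left.1 hUV he (hM' _ h)
      simp [hN, this]
    simp only [hmem]
    rw [Fintype.sum_prod_type, hp]
    refine Finset.sum_congr rfl fun k _ => ?_
    by_cases hk : e ∈ M k
    · simp only [hk, if_true]
      rw [← Finset.mul_sum, hs', mul_one]
    · simp [hk]
  · have hmem : ∀ k, e ∈ N k ↔ e ∈ M' k.2 ∧ ∀ f ∈ M k.1, ¬ G.Adj e f := by
      intro k
      have : e ∉ M k.1 := fun h => Finset.disjoint_left.1 hUV (hM _ h) he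
      simp [hN, this]
    set a := ∑ k, if ∀ f ∈ M k, ¬ G.Adj e f then y k else 0 with ha
    have hprod : (∑ k : κ × κ', if e ∈ N k then y k.1 * y' k.2 else 0) = a * q := by
      rw [← hp₂ e he, hp', ha, Finset.sum_mul_sum, Fintype.sum_prod_type]
      refine Finset.sum_congr rfl fun k _ => Finset.sum_congr rfl fun k' _ => ?_
      simp only [hmem]
      by_cases h1 : e ∈ M' k' <;> by_cases h2 : ∀ f ∈ M k, ¬ G.Adj e f <;> simp [h1, h2]
    have hq0 : 0 ≤ q := hp₂ e he ▸ hnn e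
    have ha1 : a ≤ 1 := by
      rw [← hs]
      exact Finset.sum_le_sum fun k _ => by split_ifs <;> simp [hy k]
    have ha2 : 1 / 2 ≤ a := by
      have hb : ∑ f ∈ U.filter (G.Adj e), p₁ f ≤ 1 / 2 := by
        refine le_trans ?_ (hcon e he)
        rw [← nsmul_eq_mul]
        exact Finset.sum_le_card_nsmul _ _ _ fun f hf => hp₁ f (Finset.mem_filter.1 hf).1
      have hc : 1 - ∑ f ∈ U.filter (G.Adj e), p₁ f ≤ a := by
        simp only [hp]
        rw [Finset.sum_comm, ← hs, ← Finset.sum_sub_distrib]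
        refine Finset.sum_le_sum fun k _ => ?_
        by_cases hk : ∀ f ∈ M k, ¬ G.Adj e f
        · rw [if_pos hk, sub_le_self_iff]
          exact Finset.sum_nonneg fun f _ => by split_ifs <;> simp [hy k]
        · rw [if_neg hk]
          push Not at hk
          obtain ⟨f, hfM, hef⟩ := hk
          have := Finset.single_le_sum
            (f := fun f => if f ∈ M k then y k else 0)
            (fun f _ => by split_ifs <;> simp [hy k])
            (Finset.mem_filter.2 ⟨hM k hfM, hef⟩)
          simp only [hfM, if_true] at this
          linarith
      linarith
    simp only [hprod]
    constructor <;> nlinarith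

lemma exists_le_of_sum_mul_le {κ : Type*} [Fintype κ] {y F : κ → ℝ} {a : ℝ} (hy : ∀ k, 0 ≤ y k)
    (hs : ∑ k, y k = 1) (h : ∑ k, y k * F k ≤ a) : ∃ k, F k ≤ a := by
  by_contra! hcon
  have hle : ∀ k ∈ Finset.univ, 0 ≤ y k * (F k - a) :=
    fun k _ => mul_nonneg (hy k) (sub_nonneg.2 (hcon k).le)
  have hzero : ∑ k, y k * (F k - a) = 0 := by
    refine le_antisymm ?_ (Finset.sum_nonneg hle)
    simp only [mul_sub, Finset.sum_sub_distrib, ← Finset.sum_mul, hs]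
    linarith
  have hy0 : ∀ k, y k = 0 := fun k =>
    (mul_eq_zero.1 ((Finset.sum_eq_zero_iff_of_nonneg hle).1 hzero k (Finset.mem_univ k))
      ).resolve_right (sub_pos.2 (hcon k)).ne'
  simp [hy0] at hs

lemma exp_neg_le_one_sub_half {x : ℝ} (h0 : 0 ≤ x) (h1 : x ≤ 1) :
    Real.exp (-x) ≤ 1 - x / 2 := by
  have h2 := Real.add_one_le_exp x
  rw [Real.exp_neg, inv_le_iff_one_le_mul₀ (Real.exp_pos x)]
  nlinarith

/-- Expected exponential moment of the part of a clique that a random independent set leaves. -/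
lemma sum_mul_exp_card_sdiff_le {ι κ : Type} [DecidableEq ι] [Fintype κ] {G : SimpleGraph ι}
    {R S : Finset ι} {y : κ → ℝ} {M : κ → Finset ι} {q t : ℝ}
    (hs : ∑ k, y k = 1) (hI : ∀ k, G.IsIndepSet (M k : Set ι)) (hS : G.IsClique (S : Set ι))
    (hq : ∀ e ∈ R, q ≤ ∑ k, if e ∈ M k then y k else 0) (ht0 : 0 ≤ t) (ht1 : t ≤ 1)
    (hq0 : 0 ≤ q) :
    ∑ k, y k * Real.exp (t * (S ∩ (R \ M k)).card) ≤
      Real.exp (t * (1 - q / 2) * (S ∩ R).card) := by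
  set X : ℝ := ((S ∩ R).card : ℝ) with hX
  have hcard : ∀ k, ((S ∩ (R \ M k)).card : ℝ) = X - ((S ∩ R) ∩ M k).card := by
    intro k
    have h := Finset.card_sdiff_add_card_inter (S ∩ R) (M k)
    have h' : S ∩ (R \ M k) = (S ∩ R) \ M k := by
      rw [Finset.inter_sdiff_assoc]
    rw [h', hX, ← h]
    push_cast
    ring
  have hone : ∀ k, ((S ∩ R) ∩ M k).card ≤ 1 := by
    intro k
    rw [Finset.card_le_one]
    intro e he f hf
    simp only [Finset.mem_inter] at he hf
    by_contra hef
    exact hI k (by exact_mod_cast he.2) (by exact_mod_cast hf.2) hef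
      (hS (by exact_mod_cast he.1.1) (by exact_mod_cast hf.1.1) hef)
  have hterm : ∀ k, Real.exp (t * (S ∩ (R \ M k)).card) =
      Real.exp (t * X) * (1 - (1 - Real.exp (-t)) * ((S ∩ R) ∩ M k).card) := by
    intro k
    rw [hcard]
    have := hone k
    interval_cases h : ((S ∩ R) ∩ M k).card
    · simp
    · rw [show t * (X - ((1 : ℕ) : ℝ)) = t * X + -t by push_cast; ring, Real.exp_add]
      push_cast
      ring
  have hexpect : q * X ≤ ∑ k, y k * (((S ∩ R) ∩ M k).card : ℝ) := by
    calc q * X = ∑ e ∈ S ∩ R, q := by rw [Finset.sum_const, nsmul_eq_mul, mul_comm]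
      _ ≤ ∑ e ∈ S ∩ R, ∑ k, if e ∈ M k then y k else 0 :=
          Finset.sum_le_sum fun e he => hq e (Finset.mem_inter.1 he).2
      _ = _ := by
          rw [Finset.sum_comm]
          refine Finset.sum_congr rfl fun k _ => ?_
          rw [← Finset.sum_filter, Finset.sum_const, nsmul_eq_mul, mul_comm,
            Finset.filter_mem_eq_inter]
  have hexp := exp_neg_le_one_sub_half ht0 ht1
  have hX0 : 0 ≤ X := by positivity
  calc ∑ k, y k * Real.exp (t * (S ∩ (R \ M k)).card)
      = Real.exp (t * X) *
          (1 - (1 - Real.exp (-t)) * ∑ k, y k * (((S ∩ R) ∩ M k).card : ℝ)) := by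
        simp only [hterm]
        rw [Finset.mul_sum, ← hs, ← Finset.sum_sub_distrib, Finset.mul_sum]
        exact Finset.sum_congr rfl fun k _ => by rw [hs]; ring
    _ ≤ Real.exp (t * X) * (1 - t / 2 * (q * X)) := by
        refine mul_le_mul_of_nonneg_left (sub_le_sub_left ?_ _) (Real.exp_pos _).le
        exact mul_le_mul (by linarith) hexpect (by positivity) (by linarith)
    _ ≤ Real.exp (t * X) * Real.exp (-(t / 2 * (q * X))) := by
        refine mul_le_mul_of_nonneg_left ?_ (Real.exp_pos _).le
        linarith [Real.add_one_le_exp (-(t / 2 * (q * X)))]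
    _ = _ := by
        rw [← Real.exp_add]
        congr 1
        ring

/-- Sampling `T` independent sets: a derandomised partial colouring which leaves a small part of
each clique of a given list. -/
theorem exists_partial_colouring {ι K : Type} [DecidableEq ι] {G : SimpleGraph ι}
    {U : Finset ι} {p : ι → ℝ} {q : ℝ} (hp : Realizable G U 1 p) (hpq : ∀ e ∈ U, q ≤ p e)
    (hq0 : 0 ≤ q) (hq1 : q ≤ 1) (Q : Finset K) (S : K → Finset ι)
    (hS : ∀ k ∈ Q, G.IsClique (S k : Set ι)) (w : K → ℝ) (hw : ∀ k, 0 ≤ w k) (T : ℕ) :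
    ∀ R ⊆ U, ∃ R' ⊆ R, ∃ φ : ι → ℕ, (∀ e ∈ R \ R', φ e < T) ∧
      (∀ e ∈ R \ R', ∀ f ∈ R \ R', G.Adj e f → φ e ≠ φ f) ∧
      ∑ k ∈ Q, w k * Real.exp ((S k ∩ R').card) ≤
        ∑ k ∈ Q, w k * Real.exp ((1 - q / 2) ^ T * (S k ∩ R).card) := by
  obtain ⟨κ, _, y, M, hy, -, hI, hs, hpy⟩ := hp
  induction T with
  | zero => exact fun R _ => ⟨R, subset_rfl, 0, by simp, by simp, by simp⟩
  | succ T ih =>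
    intro R hR
    set t := (1 - q / 2) ^ T with ht
    have ht0 : 0 ≤ t := pow_nonneg (by linarith) _
    have ht1 : t ≤ 1 := pow_le_one₀ (by linarith) (by linarith)
    obtain ⟨j, hj⟩ := exists_le_of_sum_mul_le (y := y)
      (F := fun j => ∑ k ∈ Q, w k * Real.exp (t * (S k ∩ (R \ M j)).card))
      (a := ∑ k ∈ Q, w k * Real.exp (t * (1 - q / 2) * (S k ∩ R).card)) hy hs (by
        simp only [Finset.mul_sum]
        rw [Finset.sum_comm]
        refine Finset.sum_le_sum fun k hk => ?_
        have := sum_mul_exp_card_sdiff_le (R := R) hs hI (hS k hk)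
          (fun e he => (hpq e (hR he)).trans (hpy e).le) ht0 ht1 hq0
        calc _ = w k * ∑ j, y j * Real.exp (t * (S k ∩ (R \ M j)).card) := by
              rw [Finset.mul_sum]
              exact Finset.sum_congr rfl fun j _ => by ring
          _ ≤ _ := mul_le_mul_of_nonneg_left this (hw k))
    obtain ⟨R', hR', φ, hφ, hproper, hle⟩ := ih (R \ M j) (Finset.sdiff_subset.trans hR)
    refine ⟨R', hR'.trans Finset.sdiff_subset, fun e => if e ∈ M j then T else φ e,
      ?_, ?_, ?_⟩
    · intro e he
      rw [Finset.mem_sdiff] at he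
      by_cases hej : e ∈ M j
      · simp [hej]
      · simp only [hej, if_false]
        exact (hφ e (by simp [he, hej])).trans (Nat.lt_succ_self T)
    · intro e he f hf hef
      rw [Finset.mem_sdiff] at he hf
      by_cases hej : e ∈ M j <;> by_cases hfj : f ∈ M j
      · exact absurd hef (hI j (by exact_mod_cast hej) (by exact_mod_cast hfj) hef.ne)
      · simp only [hej, hfj, if_true, if_false]
        exact (hφ f (by simp [hf, hfj])).ne'
      · simp only [hej, hfj, if_true, if_false]
        exact (hφ e (by simp [he, hej])).ne
      · simp only [hej, hfj, if_false]
        exact hproper e (by simp [he, hej]) f (by simp [hf, hfj]) hef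
    · rw [pow_succ]
      exact hle.trans hj

/-- Greedy colouring in decreasing order of `r`. -/
theorem exists_greedy_colouring {ι : Type} [DecidableEq ι] (G : SimpleGraph ι) (U : Finset ι)
    (r : ι → ℕ) (m : ℕ) (h : ∀ e ∈ U, (U.filter fun f => G.Adj e f ∧ r e ≤ r f).card < m) :
    ∃ φ : ι → ℕ, (∀ e ∈ U, φ e < m) ∧ ∀ e ∈ U, ∀ f ∈ U, G.Adj e f → φ e ≠ φ f := by
  suffices key : ∀ V ⊆ U, ∃ φ : ι → ℕ, (∀ e ∈ V, φ e < m) ∧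
      ∀ e ∈ V, ∀ f ∈ V, G.Adj e f → φ e ≠ φ f from key U subset_rfl
  intro V
  induction V using Finset.induction_on_min_value r with
  | empty => exact fun _ => ⟨0, by simp, by simp⟩
  | insert a V haV hmin ih =>
    intro hVU
    rw [Finset.insert_subset_iff] at hVU
    obtain ⟨φ, hφ, hproper⟩ := ih hVU.2
    obtain ⟨c, hc, hcn⟩ := Finset.exists_mem_notMem_of_card_lt_card
      (s := (V.filter (G.Adj a)).image φ) (t := Finset.range m) (by
        rw [Finset.card_range]
        refine Finset.card_image_le.trans_lt (lt_of_le_of_lt (Finset.card_le_card ?_) (h a hVU.1))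
        intro f hf
        rw [Finset.mem_filter] at hf ⊢
        exact ⟨hVU.2 hf.1, hf.2, hmin f hf.1⟩)
    have hca : ∀ f ∈ V, G.Adj a f → c ≠ φ f := by
      rintro f hf haf rfl
      exact hcn (Finset.mem_image_of_mem _ (Finset.mem_filter.2 ⟨hf, haf⟩))
    have hne : ∀ e ∈ V, e ≠ a := fun e he h => haV (h ▸ he)
    refine ⟨Function.update φ a c, ?_, ?_⟩
    · intro e he
      rcases Finset.mem_insert.1 he with rfl | he
      · simpa using hc
      · simpa [Function.update_of_ne (hne e he)] using hφ e he
    · intro e he f hf hef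
      rcases Finset.mem_insert.1 he with rfl | he' <;> rcases Finset.mem_insert.1 hf with rfl | hf'
      · exact absurd hef (G.irrefl)
      · simpa [Function.update_of_ne (hne f hf')] using hca f hf' hef
      · simpa [Function.update_of_ne (hne e he')] using (hca e he' hef.symm).symm
      · simpa [Function.update_of_ne (hne f hf'), Function.update_of_ne (hne e he')] using
          hproper e he' f hf' hef

/-- A finite set of small weights can be distributed evenly into `m` parts. -/
theorem exists_balanced_partition {ι : Type} [DecidableEq ι] (M : Finset ι) (w : ι → ℕ) (r m : ℕ)
    (hm : 0 < m) (hw : ∀ e ∈ M, w e ≤ r) :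
    ∃ g : ι → ℕ, (∀ e, g e < m) ∧
      ∀ c, m * ∑ e ∈ M.filter (fun e => g e = c), w e ≤ ∑ e ∈ M, w e + m * r := by
  induction M using Finset.induction_on with
  | empty => exact ⟨0, fun _ => hm, by simp⟩
  | insert a M ha ih =>
    obtain ⟨g, hg, hbal⟩ := ih fun e he => hw e (Finset.mem_insert_of_mem he)
    obtain ⟨c₀, hc₀, hmin⟩ := Finset.exists_le_of_sum_le (s := Finset.range m)
      (f := fun c => m * ∑ e ∈ M.filter (fun e => g e = c), w e) (g := fun _ => ∑ e ∈ M, w e)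
      ⟨0, by simpa using hm⟩ (by
        rw [← Finset.mul_sum, Finset.sum_fiberwise_of_maps_to fun e _ => Finset.mem_range.2 (hg e)]
        simp)
    refine ⟨Function.update g a c₀, fun e => ?_, fun c => ?_⟩
    · by_cases hea : e = a
      · subst hea
        simpa using hc₀
      · simpa [Function.update_of_ne hea] using hg e
    · have hM : M.filter (fun e => Function.update g a c₀ e = c) = M.filter (fun e => g e = c) := by
        refine Finset.filter_congr fun e he => ?_
        rw [Function.update_of_ne (ne_of_mem_of_not_mem he ha)]
      rw [Finset.filter_insert, hM, Finset.sum_insert ha, Function.update_self]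
      have hwa := hw a (Finset.mem_insert_self _ _)
      have hmul := Nat.mul_le_mul_left m hwa
      split_ifs with hc
      · rw [Finset.sum_insert (by simp [ha]), mul_add]
        subst hc
        linarith
      · linarith [hbal c]

/-- The intersection graph on all subsets of `Fin n`. -/
def intersectionGraph (n : ℕ) : SimpleGraph (Finset (Fin n)) where
  Adj e f := e ≠ f ∧ (e ∩ f).Nonempty
  symm := ⟨fun e f h => ⟨h.1.symm, by rw [Finset.inter_comm]; exact h.2⟩⟩
  loopless := ⟨fun _ h => h.1 rfl⟩

section Linear

variable {n : ℕ} {F : Finset (Finset (Fin n))}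

lemma LinearHG.mono {H : Finset (Finset (Fin n))} (hH : LinearHG H) (hF : F ⊆ H) : LinearHG F :=
  fun e he f hf => hH e (hF he) f (hF hf)

lemma LinearHG.eq_of_mem (hF : LinearHG F) {e f : Finset (Fin n)} (he : e ∈ F) (hf : f ∈ F)
    {x y : Fin n} (hxy : x ≠ y) (hxe : x ∈ e) (hye : y ∈ e) (hxf : x ∈ f) (hyf : y ∈ f) :
    e = f := by
  by_contra hef
  exact hxy (Finset.card_le_one.1 (hF e he f hf hef) x (Finset.mem_inter.2 ⟨hxe, hxf⟩) y
    (Finset.mem_inter.2 ⟨hye, hyf⟩))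

lemma LinearHG.card_mul_le (hF : LinearHG F) {v : Fin n} {s : ℕ}
    (h : ∀ f ∈ F, v ∈ f ∧ s + 1 ≤ f.card) : F.card * s ≤ n := by
  have hdisj : (F : Set (Finset (Fin n))).PairwiseDisjoint fun f => f.erase v := by
    intro e he f hf hef
    refine Finset.disjoint_left.2 fun x hxe hxf => hef ?_
    rw [Finset.mem_erase] at hxe hxf
    exact hF.eq_of_mem he hf hxe.1 hxe.2 (h e he).1 hxf.2 (h f hf).1
  calc F.card * s = ∑ f ∈ F, s := by simp
    _ ≤ ∑ f ∈ F, (f.erase v).card := by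
        refine Finset.sum_le_sum fun f hf => ?_
        rw [Finset.card_erase_of_mem (h f hf).1]
        have := (h f hf).2
        omega
    _ = (F.biUnion fun f => f.erase v).card := (Finset.card_biUnion hdisj).symm
    _ ≤ n := by simpa using Finset.card_le_univ (F.biUnion fun f => f.erase v)

/-- A vertex degree bound, in a form convenient for edge sizes at least two. -/
lemma LinearHG.card_le (hF : LinearHG F) {v : Fin n} {s : ℕ} (hs : 2 ≤ s)
    (h : ∀ f ∈ F, v ∈ f ∧ s ≤ f.card) : (F.card : ℝ) ≤ 2 * n / s := by
  have h1 := hF.card_mul_le (v := v) (s := s - 1) fun f hf => ⟨(h f hf).1, by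
    have := (h f hf).2; omega⟩
  have h2 : F.card * s ≤ 2 * n := by
    calc F.card * s ≤ F.card * (2 * (s - 1)) := Nat.mul_le_mul_left _ (by omega)
      _ = 2 * (F.card * (s - 1)) := by ring
      _ ≤ 2 * n := Nat.mul_le_mul_left _ h1
  rw [le_div_iff₀ (by positivity)]
  exact_mod_cast h2

lemma card_filter_adj_le (F : Finset (Finset (Fin n))) (e : Finset (Fin n)) {d : ℝ}
    (h : ∀ v ∈ e, ((F.filter fun f => v ∈ f).card : ℝ) ≤ d) :
    ((F.filter ((intersectionGraph n).Adj e)).card : ℝ) ≤ e.card * d := by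
  have hsub : F.filter ((intersectionGraph n).Adj e) ⊆
      e.biUnion fun v => F.filter fun f => v ∈ f := by
    intro f hf
    rw [Finset.mem_filter] at hf
    obtain ⟨v, hv⟩ := hf.2.2
    rw [Finset.mem_inter] at hv
    simp only [Finset.mem_biUnion, Finset.mem_filter]
    exact ⟨v, hv.1, hf.1, hv.2⟩
  calc ((F.filter ((intersectionGraph n).Adj e)).card : ℝ)
      ≤ ∑ v ∈ e, ((F.filter fun f => v ∈ f).card : ℝ) := by
        exact_mod_cast (Finset.card_le_card hsub).trans Finset.card_biUnion_le
    _ ≤ ∑ v ∈ e, d := Finset.sum_le_sum h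
    _ = e.card * d := by simp

lemma LinearHG.card_filter_adj_le (hF : LinearHG F) (e : Finset (Fin n)) {s : ℕ} (hs : 2 ≤ s)
    (h : ∀ f ∈ F, s ≤ f.card) :
    ((F.filter ((intersectionGraph n).Adj e)).card : ℝ) ≤ e.card * (2 * n / s) :=
  _root_.card_filter_adj_le F e fun _ _ => (hF.mono (Finset.filter_subset _ _)).card_le hs
    fun f hf => ⟨(Finset.mem_filter.1 hf).2, h f (Finset.mem_filter.1 hf).1⟩

lemma LinearHG.codegree_le (hF : LinearHG F) {e f : Finset (Fin n)} (he : e ∈ F) (hf : f ∈ F)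
    (hef : (intersectionGraph n).Adj e f) {s : ℕ} (hs : 2 ≤ s) (h : ∀ f ∈ F, s ≤ f.card) :
    ((F.filter fun g => (intersectionGraph n).Adj f g ∧
      (g = e ∨ (intersectionGraph n).Adj e g)).card : ℝ) ≤ 2 * n / s + e.card * f.card + 1 := by
  obtain ⟨v, hv⟩ := hef.2
  rw [Finset.mem_inter] at hv
  set P := (e ×ˢ f).filter fun x => x.1 ≠ x.2 with hP
  set A := F.filter fun g => v ∈ g with hA
  set B := P.biUnion fun x => F.filter fun g => x.1 ∈ g ∧ x.2 ∈ g with hB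
  have hsub : (F.filter fun g => (intersectionGraph n).Adj f g ∧
      (g = e ∨ (intersectionGraph n).Adj e g)) ⊆ (A ∪ B) ∪ {e} := by
    intro g hg
    simp only [Finset.mem_filter] at hg
    obtain ⟨hgF, hfg, rfl | heg⟩ := hg
    · simp
    by_cases hvg : v ∈ g
    · simp [hA, hgF, hvg]
    obtain ⟨y, hy⟩ := hfg.2
    obtain ⟨x, hx⟩ := heg.2
    rw [Finset.mem_inter] at hx hy
    have hxy : x ≠ y := by
      rintro rfl
      refine hef.1 (hF.eq_of_mem he hf (x := x) (y := v) ?_ hx.1 hv.1 hy.1 hv.2)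
      rintro rfl
      exact hvg hx.2
    refine Finset.mem_union_left _ (Finset.mem_union_right _ ?_)
    simp only [hB, hP, Finset.mem_biUnion, Finset.mem_filter, Finset.mem_product]
    exact ⟨(x, y), ⟨⟨hx.1, hy.1⟩, hxy⟩, hgF, hx.2, hy.2⟩
  have hBcard : B.card ≤ e.card * f.card := by
    refine (Finset.card_biUnion_le_card_mul P _ 1 fun x hx => ?_).trans ?_
    · rw [Finset.card_le_one]
      intro g hg g' hg'
      rw [Finset.mem_filter] at hg hg' hx
      exact hF.eq_of_mem hg.1 hg'.1 hx.2 hg.2.1 hg.2.2 hg'.2.1 hg'.2.2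
    · rw [mul_one, ← Finset.card_product]
      exact Finset.card_filter_le _ _
  have hAcard : (A.card : ℝ) ≤ 2 * n / s :=
    (hF.mono (Finset.filter_subset _ _)).card_le hs (v := v)
      fun f hf => ⟨(Finset.mem_filter.1 hf).2, h f (Finset.mem_filter.1 hf).1⟩
  have hcard := (Finset.card_le_card hsub).trans
    ((Finset.card_union_le _ _).trans (add_le_add_left (Finset.card_union_le _ _) _))
  rw [Finset.card_singleton] at hcard
  have hcard' : ((F.filter fun g => (intersectionGraph n).Adj f g ∧
      (g = e ∨ (intersectionGraph n).Adj e g)).card : ℝ) ≤ A.card + B.card + 1 := by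
    exact_mod_cast hcard
  have : (B.card : ℝ) ≤ e.card * f.card := by exact_mod_cast hBcard
  linarith

end Linear

/-- Fractional edge-colouring of a linear hypergraph whose edge sizes are within a bounded
factor of each other. -/
theorem exists_fractional_edgeColouring_of_similar_sizes (B C : ℝ) (hB : 0 < B) (hC : 0 < C) :
    ∃ a₀ : ℕ, ∀ r : ℕ, ∃ n₀ : ℕ, ∀ n : ℕ, n₀ ≤ n → ∀ F : Finset (Finset (Fin n)), LinearHG F →
      ∀ a : ℕ, a₀ ≤ a → (∀ e ∈ F, a ≤ e.card ∧ (e.card : ℝ) ≤ B * a ∧ e.card ≤ r) →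
        ∃ p, Realizable (intersectionGraph n) F 1 p ∧ ∀ e ∈ F, p e = C / n := by
  set T := 4 * B * C with hT
  set K := 4 * C * Real.exp (2 * T) with hK
  have hT0 : 0 < T := by positivity
  have hK0 : 0 < K := by positivity
  refine ⟨⌈16 * K⌉₊ + 2, fun r => ⟨⌈2 * K⌉₊ + ⌈8 * K * (r * r + 1)⌉₊ + 1, ?_⟩⟩
  intro n hn F hF a ha hsize
  have hn0 : (0 : ℝ) < n := by
    have : 0 < n := by omega
    exact_mod_cast this
  have hnK : 2 * K ≤ n := (Nat.le_ceil _).trans (by exact_mod_cast (by omega))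
  have hnr : 8 * K * (r * r + 1) ≤ n := (Nat.le_ceil _).trans (Nat.cast_le.2 (by omega))
  have haK : 16 * K ≤ a := (Nat.le_ceil _).trans (by exact_mod_cast (by omega))
  have ha2 : 2 ≤ a := by omega
  have ha0 : (0 : ℝ) < a := by positivity
  have hl : 0 < K / n := by positivity
  obtain ⟨p, hp, hp1⟩ := exists_realizable_eq_one_of_codegree (intersectionGraph n) F
    (l := K / n) (D := 2 * B * n) (T := T) hl
    (by rw [div_le_iff₀ hn0]; linarith) hT0 (by positivity)
    (fun e he => by
      refine (hF.card_filter_adj_le e ha2 fun f hf => (hsize f hf).1).trans ?_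
      calc (e.card : ℝ) * (2 * n / a) ≤ B * a * (2 * n / a) :=
            mul_le_mul_of_nonneg_right (hsize e he).2.1 (by positivity)
        _ = 2 * B * n := by field_simp)
    (fun e he f hf hef => by
      have h1 := hF.codegree_le he hf hef ha2 fun f hf => (hsize f hf).1
      have h2 : (e.card : ℝ) * f.card ≤ r * r := by
        exact_mod_cast Nat.mul_le_mul (hsize e he).2.2 (hsize f hf).2.2
      calc K / n * _ ≤ K / n * (2 * n / a + (r * r + 1)) :=
            mul_le_mul_of_nonneg_left (by linarith) hl.le
        _ = 2 * K / a + K * (r * r + 1) / n := by field_simp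
        _ ≤ 1 / 8 + 1 / 8 := by
            refine add_le_add ?_ ?_
            · rw [div_le_iff₀ ha0]; linarith
            · rw [div_le_iff₀ hn0]; linarith
        _ = 1 / 4 := by norm_num)
  refine ⟨(C / n) • p, ?_, fun e he => by simp [hp1 e he]⟩
  have := hp.smul (c := C / n) (by positivity)
  convert this using 1
  rw [hK, hT]
  field_simp
  norm_num

/-- Fractional edge-colouring when edges of distinct scales have very different sizes. -/
theorem exists_fractional_edgeColouring_of_parity (C : ℕ) (hC : 0 < C) :
    ∃ a₀ : ℕ, ∀ r : ℕ, ∃ n₀ : ℕ, ∀ n : ℕ, n₀ ≤ n → ∀ ρ : ℕ, ∀ F : Finset (Finset (Fin n)),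
      LinearHG F → (∀ e ∈ F, a₀ ≤ e.card ∧ e.card ≤ r ∧ Nat.log (4 * C) e.card % 2 = ρ) →
        ∃ p, Realizable (intersectionGraph n) F 1 p ∧
          ∀ e ∈ F, (C : ℝ) / n / 2 ≤ p e ∧ p e ≤ C / n := by
  set b := 4 * C with hb
  have hb1 : 1 < b := by omega
  have hbC : (b : ℝ) = 4 * C := by rw [hb]; push_cast; ring
  have hC0 : (0 : ℝ) < C := by exact_mod_cast hC
  obtain ⟨a₁, h₁⟩ := exists_fractional_edgeColouring_of_similar_sizes b C
    (by positivity) hC0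
  refine ⟨b * a₁ + 1, fun r => ?_⟩
  obtain ⟨n₁, h₁⟩ := h₁ r
  refine ⟨n₁ + 1, fun n hn ρ F => ?_⟩
  have hn0 : (0 : ℝ) < n := by
    have : 0 < n := by omega
    exact_mod_cast this
  induction F using Finset.strongInduction with
  | H F ih =>
    intro hF hsize
    rcases F.eq_empty_or_nonempty with rfl | hne
    · exact ⟨0, .of_const zero_le_one, by simp⟩
    obtain ⟨e₀, he₀, hmin⟩ := Finset.exists_min_image F (fun e => Nat.log b e.card) hne
    set j := Nat.log b e₀.card with hj
    set U := F.filter fun e => Nat.log b e.card ≠ j with hU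
    set V := F.filter fun e => Nat.log b e.card = j with hV
    have hpos : ∀ e ∈ F, e.card ≠ 0 := fun e he => by
      have := (hsize e he).1
      omega
    have hVlt : ∀ e ∈ V, e.card < b ^ (j + 1) := by
      intro e he
      rw [hV, Finset.mem_filter] at he
      rw [← he.2]
      exact Nat.lt_pow_succ_log_self hb1 _
    have hUge : ∀ e ∈ U, b ^ (j + 2) ≤ e.card := by
      intro e he
      rw [hU, Finset.mem_filter] at he
      refine Nat.pow_le_of_le_log (hpos e he.1) ?_
      have h1 := hmin e he.1
      have h2 := (hsize e he.1).2.2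
      have h3 := (hsize e₀ he₀).2.2
      have h4 := he.2
      omega
    have hUF : U ⊆ F := Finset.filter_subset _ _
    have hVF : V ⊆ F := Finset.filter_subset _ _
    have hssub : U ⊂ F := by
      refine Finset.ssubset_iff_subset_ne.2 ⟨hUF, fun h => ?_⟩
      rw [← h, hU, Finset.mem_filter] at he₀
      exact he₀.2 rfl
    obtain ⟨p₁, hp₁, hp₁'⟩ := ih U hssub (hF.mono hUF) fun e he => hsize e (hUF he)
    obtain ⟨p₂, hp₂, hp₂'⟩ := h₁ n (by omega) V (hF.mono hVF) (b ^ j) (by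
        have h1 := (hsize e₀ he₀).1
        have h2 : e₀.card < b ^ (j + 1) := Nat.lt_pow_succ_log_self hb1 _
        rw [pow_succ'] at h2
        exact (Nat.lt_of_mul_lt_mul_left (a := b) (by omega)).le) (by
        intro e he
        refine ⟨?_, ?_, (hsize e (hVF he)).2.1⟩
        · rw [hV, Finset.mem_filter] at he
          rw [← he.2]
          exact Nat.pow_log_le_self _ (hpos e he.1)
        · have := (hVlt e he).le
          rw [pow_succ'] at this
          exact_mod_cast this)
    obtain ⟨p, hp, hpU, hpV⟩ := hp₁.exists_union hp₂
      (Finset.disjoint_filter.2 fun e _ h h' => h h') (fun e he => (hp₁' e he).2) hp₂' (by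
        intro e he
        have h2 : 2 ≤ b ^ (j + 2) := hb1.trans_le (Nat.le_self_pow (by omega) _)
        have h3 := (hF.mono hUF).card_filter_adj_le e h2 hUge
        have h4 : (e.card : ℝ) ≤ b ^ (j + 1) := by exact_mod_cast (hVlt e he).le
        have hb0 : (0 : ℝ) < b := by positivity
        calc _ ≤ (b : ℝ) ^ (j + 1) * (2 * n / (b ^ (j + 2) : ℕ)) * (C / n) := by
              refine mul_le_mul_of_nonneg_right (h3.trans ?_) (by positivity)
              exact mul_le_mul_of_nonneg_right h4 (by positivity)
          _ = 2 * C / b := by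
              push_cast
              rw [pow_succ _ (j + 1)]
              field_simp
          _ = 1 / 2 := by rw [hbC]; field_simp; norm_num
          _ ≤ 1 / 2 := le_rfl)
    have hunion : U ∪ V = F := by
      rw [hU, hV, Finset.union_comm]
      exact Finset.filter_union_filter_not_eq _ _
    rw [hunion] at hp
    refine ⟨p, hp, fun e he => ?_⟩
    by_cases hej : Nat.log b e.card = j
    · exact hpV e (by simp [hV, he, hej])
    · have heU : e ∈ U := by simp [hU, he, hej]
      rw [hpU e heU]
      exact hp₁' e heU

/-- Fractional edge-colouring of a linear hypergraph with large edges. -/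
theorem exists_fractional_edgeColouring (C : ℕ) (hC : 0 < C) :
    ∃ a₀ : ℕ, ∀ r : ℕ, ∃ n₀ : ℕ, ∀ n : ℕ, n₀ ≤ n → ∀ F : Finset (Finset (Fin n)),
      LinearHG F → (∀ e ∈ F, a₀ ≤ e.card ∧ e.card ≤ r) →
        ∃ p, Realizable (intersectionGraph n) F 1 p ∧ ∀ e ∈ F, (C : ℝ) / n / 4 ≤ p e := by
  obtain ⟨a₀, h⟩ := exists_fractional_edgeColouring_of_parity C hC
  refine ⟨a₀, fun r => ?_⟩
  obtain ⟨n₀, h⟩ := h r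
  refine ⟨n₀, fun n hn F hF hsize => ?_⟩
  have key : ∀ ρ, ∃ p, Realizable (intersectionGraph n) F 1 p ∧
      ∀ e ∈ F, Nat.log (4 * C) e.card % 2 = ρ → (C : ℝ) / n / 2 ≤ p e := by
    intro ρ
    have hsub : F.filter (fun e => Nat.log (4 * C) e.card % 2 = ρ) ⊆ F := Finset.filter_subset _ _
    obtain ⟨p, hp, hp'⟩ := h n hn ρ _ (hF.mono hsub) fun e he => by
      rw [Finset.mem_filter] at he
      exact ⟨(hsize e he.1).1, (hsize e he.1).2, he.2⟩
    exact ⟨p, hp.mono hsub, fun e he heρ => (hp' e (Finset.mem_filter.2 ⟨he, heρ⟩)).1⟩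
  obtain ⟨p, hp, hp'⟩ := key 0
  obtain ⟨q, hq, hq'⟩ := key 1
  refine ⟨(1 / 2 : ℝ) • p + (1 / 2 : ℝ) • q, ?_, fun e he => ?_⟩
  · convert (hp.smul (c := 1 / 2) (by norm_num)).add (hq.smul (c := 1 / 2) (by norm_num)) using 1
    norm_num
  · have h1 := hp.nonneg e
    have h2 := hq.nonneg e
    simp only [Pi.add_apply, Pi.smul_apply, smul_eq_mul]
    rcases Nat.mod_two_eq_zero_or_one (Nat.log (4 * C) e.card) with h0 | h0
    · have := hp' e he h0
      linarith
    · have := hq' e he h0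
      linarith

/-- An edge-colouring of a linear hypergraph with large edges by few colours. -/
theorem exists_edgeColouring (ε : ℝ) (hε : 0 < ε) :
    ∃ a₀ : ℕ, ∀ r : ℕ, ∃ n₀ : ℕ, ∀ n : ℕ, n₀ ≤ n → ∀ H : Finset (Finset (Fin n)),
      LinearHG H → (∀ e ∈ H, a₀ ≤ e.card ∧ e.card ≤ r) →
        ∃ ψ, IsProperEC H ψ ∧ ∀ e ∈ H, ψ e < 2 * ⌊ε * n⌋₊ := by
  set C := ⌈256 / ε ^ 2⌉₊ with hC
  have hCε : 256 / ε ^ 2 ≤ C := Nat.le_ceil _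
  have hC0 : 0 < C := Nat.ceil_pos.2 (by positivity)
  obtain ⟨a₁, h₁⟩ := exists_fractional_edgeColouring C hC0
  refine ⟨a₁ + 2, fun r => ?_⟩
  obtain ⟨n₁, h₁⟩ := h₁ r
  have hlog : ∀ᶠ n : ℕ in Filter.atTop, r * Real.log (n * (r + 1 : ℕ)) ≤ ε / 8 * n := by
    have hlo := (Real.isLittleO_log_id_atTop.comp_tendsto
      (tendsto_natCast_atTop_atTop.atTop_mul_const (r := ((r + 1 : ℕ) : ℝ))
        (by positivity))).def (c := ε / 8 / ((r + 1 : ℕ) * (r + 1 : ℕ))) (by positivity)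
    filter_upwards [hlo, Filter.eventually_ge_atTop 1] with n hn hn1
    have hn1' : (1 : ℝ) ≤ n := by exact_mod_cast hn1
    have hr1 : (1 : ℝ) ≤ (r + 1 : ℕ) := by exact_mod_cast Nat.le_add_left 1 r
    have hl0 : 0 ≤ Real.log (n * (r + 1 : ℕ)) := Real.log_nonneg (by nlinarith)
    simp only [Function.comp_apply, id, Real.norm_eq_abs] at hn
    rw [abs_of_nonneg hl0, abs_of_nonneg (by positivity)] at hn
    calc r * Real.log (n * (r + 1 : ℕ)) ≤ (r + 1 : ℕ) * Real.log (n * (r + 1 : ℕ)) :=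
          mul_le_mul_of_nonneg_right (by push_cast; linarith) hl0
      _ ≤ (r + 1 : ℕ) * (ε / 8 / ((r + 1 : ℕ) * (r + 1 : ℕ)) * (n * (r + 1 : ℕ))) :=
          mul_le_mul_of_nonneg_left hn (by positivity)
      _ = ε / 8 * n := by
          have : ((r + 1 : ℕ) : ℝ) ≠ 0 := by positivity
          field_simp
  obtain ⟨n₀, hn₀⟩ := Filter.eventually_atTop.1 (hlog.and (Filter.eventually_ge_atTop
    (n₁ + C + ⌈2 / ε⌉₊)))
  refine ⟨n₀, fun n hn H hH hsize => ?_⟩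
  obtain ⟨hlogn, hnbig⟩ := hn₀ n hn
  have hnC : (C : ℝ) ≤ n := Nat.cast_le.2 (by omega)
  have hn0 : (0 : ℝ) < n := lt_of_lt_of_le (by exact_mod_cast hC0) hnC
  have hnε : 2 ≤ ε * n := by
    rw [← div_le_iff₀' hε]
    exact (Nat.le_ceil _).trans (Nat.cast_le.2 (by omega))
  obtain ⟨p, hp, hpC⟩ := h₁ n (by omega) H hH fun e he =>
    ⟨by have := (hsize e he).1; omega, (hsize e he).2⟩
  set q : ℝ := C / n / 4 with hq
  have hq0 : 0 ≤ q := by positivity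
  have hq1 : q ≤ 1 := by
    have : (C : ℝ) / n ≤ 1 := (div_le_one hn0).2 hnC
    linarith
  set T := ⌊ε * n⌋₊ with hT
  have hTε : ε * n / 2 ≤ T := by
    have := Nat.lt_floor_add_one (ε * n)
    linarith
  set θ := (1 - q / 2) ^ T with hθ
  have hθ0 : 0 ≤ θ := pow_nonneg (by linarith) _
  have hθε : θ ≤ ε / 16 := by
    have h1 : 16 / ε ≤ q / 2 * T := by
      calc 16 / ε = 256 / ε ^ 2 * ε / 16 := by field_simp; norm_num
        _ ≤ C * ε / 16 := by gcongr
        _ = q / 2 * (ε * n / 2) := by rw [hq]; field_simp; norm_num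
        _ ≤ q / 2 * T := by gcongr
    have h2 : θ ≤ Real.exp (-(q / 2 * T)) := by
      calc θ ≤ Real.exp (-(q / 2)) ^ T := by
            refine pow_le_pow_left₀ (by linarith) ?_ _
            have := Real.add_one_le_exp (-(q / 2))
            linarith
        _ = _ := by rw [← Real.exp_nat_mul]; ring_nf
    refine h2.trans ?_
    rw [Real.exp_neg]
    have h3 := Real.add_one_le_exp (q / 2 * T)
    have h4 : (16 / ε)⁻¹ = ε / 16 := inv_div _ _
    rw [← h4]
    exact inv_anti₀ (by positivity) (by linarith)
  set S : Fin n × ℕ → Finset (Finset (Fin n)) :=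
    fun x => H.filter fun e => x.1 ∈ e ∧ x.2 ≤ e.card with hS
  obtain ⟨R, hRH, φ₁, hφ₁, hφ₁p, hsum⟩ := exists_partial_colouring hp hpC hq0 hq1
    ((Finset.univ : Finset (Fin n)) ×ˢ Finset.range (r + 1)) S
    (fun x _ e he f hf hef => by
      simp only [hS, Finset.coe_filter, Set.mem_ofPred_eq] at he hf
      exact ⟨hef, x.1, Finset.mem_inter.2 ⟨he.2.1, hf.2.1⟩⟩)
    (fun x => Real.exp (-(θ * (S x ∩ H).card))) (fun _ => (Real.exp_pos _).le) T H subset_rfl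
  have hdeg : ∀ v : Fin n, ∀ s ≤ r, 2 ≤ s → ((S (v, s) ∩ R).card : ℝ) ≤
      θ * (2 * n / s) + Real.log (n * (r + 1 : ℕ)) := by
    intro v s hs hs2
    have h1 : ((S (v, s) ∩ H).card : ℝ) ≤ 2 * n / s := by
      refine (hH.mono Finset.inter_subset_right).card_le (v := v) hs2 fun f hf => ?_
      exact (Finset.mem_filter.1 (Finset.mem_inter.1 hf).1).2
    have h2 : Real.exp (-(θ * (S (v, s) ∩ H).card)) * Real.exp ((S (v, s) ∩ R).card) ≤
        n * (r + 1 : ℕ) := by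
      refine (Finset.single_le_sum (f := fun x => Real.exp (-(θ * (S x ∩ H).card)) *
        Real.exp ((S x ∩ R).card)) (fun x _ => by positivity) (Finset.mem_product.2
          ⟨Finset.mem_univ v, Finset.mem_range.2 (Nat.lt_succ_of_le hs)⟩)).trans (hsum.trans ?_)
      simp only [← hθ, ← Real.exp_add, neg_add_cancel, Real.exp_zero]
      simp
    rw [← Real.exp_add, ← Real.le_log_iff_exp_le (by positivity)] at h2
    have h3 := mul_le_mul_of_nonneg_left h1 hθ0
    linarith
  obtain ⟨φ₂, hφ₂, hφ₂p⟩ := exists_greedy_colouring (intersectionGraph n) R Finset.card T (by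
    intro e he
    have hes := hsize e (hRH he)
    have he0 : (0 : ℝ) < e.card := by
      have : 0 < e.card := by omega
      exact_mod_cast this
    have hl0 : 0 ≤ Real.log (n * (r + 1 : ℕ)) := by
      have h1 : (1 : ℕ) ≤ n * (r + 1) := Nat.mul_pos (by exact_mod_cast hn0) (by omega)
      exact Real.log_nonneg (by exact_mod_cast h1)
    have h1 := card_filter_adj_le (R.filter fun f => e.card ≤ f.card) e
      (d := θ * (2 * n / e.card) + Real.log (n * (r + 1 : ℕ))) fun v _ => by
        refine le_trans (Nat.cast_le.2 (Finset.card_le_card fun f hf => ?_))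
          (hdeg v e.card hes.2 (by omega))
        simp only [Finset.mem_filter] at hf
        simp only [hS, Finset.mem_inter, Finset.mem_filter]
        exact ⟨⟨hRH hf.1.1, hf.2, hf.1.2⟩, hf.1.1⟩
    rw [Finset.filter_filter] at h1
    simp only [and_comm (a := e.card ≤ _)] at h1
    have h2 : (e.card : ℝ) * (θ * (2 * n / e.card) + Real.log (n * (r + 1 : ℕ))) ≤
        ε / 16 * (2 * n) + ε / 8 * n := by
      calc _ = θ * (2 * n) + e.card * Real.log (n * (r + 1 : ℕ)) := by field_simp
        _ ≤ ε / 16 * (2 * n) + r * Real.log (n * (r + 1 : ℕ)) := by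
            gcongr
            exact hes.2
        _ ≤ _ := by linarith
    have h3 : ε / 16 * (2 * n) + ε / 8 * n < T := by nlinarith
    exact_mod_cast (h1.trans h2).trans_lt h3)
  refine ⟨fun e => if e ∈ R then T + φ₂ e else φ₁ e, fun e he f hf hef hne => ?_, fun e he => ?_⟩
  · have hlt : ∀ g ∈ H, g ∉ R → φ₁ g < T := fun g hg hgR => hφ₁ g (Finset.mem_sdiff.2 ⟨hg, hgR⟩)
    have hadj : (intersectionGraph n).Adj e f := ⟨hef, hne⟩
    by_cases heR : e ∈ R <;> by_cases hfR : f ∈ R <;> simp only [heR, hfR, if_true, if_false]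
    · have := hφ₂p e heR f hfR hadj
      omega
    · have := hlt f hf hfR
      omega
    · have := hlt e he heR
      omega
    · exact hφ₁p e (Finset.mem_sdiff.2 ⟨he, heR⟩) f (Finset.mem_sdiff.2 ⟨hf, hfR⟩) hadj
  · by_cases heR : e ∈ R
    · have := hφ₂ e heR
      simp only [heR, if_true]
      omega
    · have := hφ₁ e (Finset.mem_sdiff.2 ⟨he, heR⟩)
      simp only [heR, if_false]
      omega

/-- Refining a proper edge-colouring so that every colour covers few vertices. -/
theorem exists_refinement_edgeColouring {n : ℕ} {H : Finset (Finset (Fin n))}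
    {ψ : Finset (Fin n) → ℕ} (hψ : IsProperEC H ψ) {L r m : ℕ} (hL : ∀ e ∈ H, ψ e < L)
    (hr : ∀ e ∈ H, e.card ≤ r) (hm : 0 < m) :
    ∃ φ, (∀ e ∈ H, φ e < L * m) ∧ IsProperEC H φ ∧
      ∀ c, m * (vertsColoured H φ c).card ≤ n + m * r := by
  choose g hg hbal using fun c => exists_balanced_partition (H.filter fun e => ψ e = c)
    Finset.card r m hm fun e he => hr e (Finset.mem_filter.1 he).1
  have hdiv : ∀ e, (ψ e * m + g (ψ e) e) / m = ψ e := fun e => by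
    rw [mul_comm, Nat.mul_add_div hm, Nat.div_eq_of_lt (hg _ _), add_zero]
  have hmod : ∀ e, (ψ e * m + g (ψ e) e) % m = g (ψ e) e := fun e => by
    rw [Nat.mul_add_mod', Nat.mod_eq_of_lt (hg _ _)]
  refine ⟨fun e => ψ e * m + g (ψ e) e, fun e he => ?_, fun e he f hf hef hne h => ?_, fun c => ?_⟩
  · rw [← Nat.div_lt_iff_lt_mul hm, hdiv]
    exact hL e he
  · refine hψ e he f hf hef hne ?_
    rw [← hdiv e, ← hdiv f]
    exact congrArg (· / m) h
  · have hsub : vertsColoured H (fun e => ψ e * m + g (ψ e) e) c ⊆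
        ((H.filter fun e => ψ e = c / m).filter fun e => g (c / m) e = c % m).biUnion id := by
      intro v hv
      simp only [vertsColoured, Finset.mem_filter, Finset.mem_univ, true_and] at hv
      obtain ⟨e, he, rfl, hve⟩ := hv
      simp only [Finset.mem_biUnion, Finset.mem_filter, id, hdiv, hmod]
      exact ⟨e, ⟨⟨he, rfl⟩, rfl⟩, hve⟩
    have hdisj : ((H.filter fun e => ψ e = c / m : Finset _) :
        Set (Finset (Fin n))).PairwiseDisjoint id := by
      intro e he f hf hef
      simp only [Finset.coe_filter, Set.mem_ofPred_eq] at he hf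
      simp only [Function.onFun, id, Finset.disjoint_iff_inter_eq_empty]
      by_contra hne
      exact hψ e he.1 f hf.1 hef (Finset.nonempty_iff_ne_empty.2 hne) (he.2.trans hf.2.symm)
    calc m * _ ≤ m * ∑ e ∈ (H.filter fun e => ψ e = c / m).filter fun e => g (c / m) e = c % m,
          e.card := Nat.mul_le_mul_left _ ((Finset.card_le_card hsub).trans Finset.card_biUnion_le)
      _ ≤ ∑ e ∈ H.filter (fun e => ψ e = c / m), e.card + m * r := hbal _ _
      _ = ((H.filter fun e => ψ e = c / m).biUnion id).card + m * r := by
          rw [Finset.card_biUnion hdisj]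
          rfl
      _ ≤ n + m * r := by
          refine Nat.add_le_add_right ?_ _
          simpa using Finset.card_le_univ ((H.filter fun e => ψ e = c / m).biUnion id)

/-- Colouring medium edges: for every `γ ∈ (0,1)` there is `r1` such that for every `r0`
sufficiently large in terms of `r1` and every sufficiently large `n`, every `n`-vertex linear
hypergraph with all edge sizes in `[r1, r0]` has a `γ`-bounded proper edge-colouring using at
most `γn` colours. -/
theorem medium_edge_colouring :
    ∀ γ : ℝ, 0 < γ → γ < 1 →
      ∃ r1 : ℕ, ∃ r0min : ℕ, ∀ r0 : ℕ, r0min ≤ r0 →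
        ∃ n0 : ℕ, ∀ n : ℕ, n0 ≤ n →
          ∀ H : Finset (Finset (Fin n)), LinearHG H →
            (∀ e ∈ H, r1 ≤ e.card ∧ e.card ≤ r0) →
            ∃ (k : ℕ) (φ : Finset (Fin n) → ℕ),
              (k : ℝ) ≤ γ * n ∧ (∀ e ∈ H, φ e < k) ∧ IsProperEC H φ ∧
                AlphaBounded H φ γ := by
  intro γ hγ _
  set m := ⌈2 / γ⌉₊ with hm
  have hmγ : 2 / γ ≤ m := Nat.le_ceil _
  have hm0 : 0 < m := Nat.ceil_pos.2 (by positivity)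
  have hm0' : (0 : ℝ) < m := by exact_mod_cast hm0
  obtain ⟨r1, h⟩ := exists_edgeColouring (γ / (2 * m)) (by positivity)
  refine ⟨r1, 0, fun r0 _ => ?_⟩
  obtain ⟨n₀, h⟩ := h r0
  refine ⟨n₀ + ⌈2 * r0 / γ⌉₊, fun n hn H hH hsize => ?_⟩
  obtain ⟨ψ, hψ, hψL⟩ := h n (by omega) H hH hsize
  obtain ⟨φ, hφ, hφp, hφb⟩ :=
    exists_refinement_edgeColouring hψ hψL (fun e he => (hsize e he).2) hm0
  refine ⟨_, φ, ?_, hφ, hφp, fun c => Or.inr ?_⟩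
  · have hfloor : (⌊γ / (2 * m) * n⌋₊ : ℝ) ≤ γ / (2 * m) * n := Nat.floor_le (by positivity)
    push_cast
    calc 2 * (⌊γ / (2 * m) * n⌋₊ : ℝ) * m ≤ 2 * (γ / (2 * m) * n) * m := by gcongr
      _ = γ * n := by field_simp
  · have hr0 : 2 * r0 / γ ≤ n := (Nat.le_ceil _).trans (Nat.cast_le.2 (by omega))
    have hb : (m : ℝ) * (vertsColoured H φ c).card ≤ n + m * r0 := by exact_mod_cast hφb c
    rw [div_le_iff₀ hγ] at hr0 hmγ
    have h1 : 2 * (n : ℝ) ≤ m * γ * n := mul_le_mul_of_nonneg_right hmγ (by positivity)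
    have h2 : (m : ℝ) * (2 * r0) ≤ m * (n * γ) := mul_le_mul_of_nonneg_left hr0 hm0'.le
    refine le_of_mul_le_mul_left ?_ hm0'
    linarith
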